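/- arXiv:1606.00598 — 6 statements merged into one kernel-verified Lean document; each statement's English description precedes it below -/
import Mathlib

section
/- Let (a_n)_{n≥0} be a sequence of positive real numbers with a_0 ≥ 1, and let C₁, C₂ ≥ 0 be real constants such that a_n ≤ a_{n-1} + C₁(√(a_{n-1}) + √(a_{n-1} + C₂)) for all n ≥ 1. Then there exists a positive constant C̃ depending only on C₁ and C₂ such that a_n ≤ C̃ · n² · a_0 for all n ≥ 1. -/
/-- Lemma A.1: for a positive real sequence with `a 0 ≥ 1` satisfying
`a n ≤ a (n-1) + C₁(√(a (n-1)) + √(a (n-1) + C₂))`, there is a constant `C̃ > 0`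
depending only on `C₁, C₂` with `a n ≤ C̃ n² a 0` for all `n ≥ 1`. -/
theorem stmt_0 (C₁ C₂ : ℝ) (hC₁ : 0 ≤ C₁) (hC₂ : 0 ≤ C₂) :
    ∃ Ct : ℝ, 0 < Ct ∧ ∀ a : ℕ → ℝ, (∀ n, 0 < a n) → 1 ≤ a 0 →
      (∀ n, 1 ≤ n →
        a n ≤ a (n - 1) + C₁ * (Real.sqrt (a (n - 1)) + Real.sqrt (a (n - 1) + C₂))) →
      ∀ n, 1 ≤ n → a n ≤ Ct * (n : ℝ) ^ 2 * a 0 := by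
  obtain ⟨K, hK⟩ : ∃ K : ℝ, K = C₁ * (2 + C₂) := ⟨_, rfl⟩
  have hK0 : 0 ≤ K := by rw [hK]; positivity
  refine ⟨(1 + K) ^ 2, by positivity, ?_⟩
  intro a _ h0 hrec
  obtain ⟨s, hs⟩ : ∃ s : ℝ, s = Real.sqrt (a 0) := ⟨_, rfl⟩
  have hs1 : 1 ≤ s := by rw [hs]; exact Real.one_le_sqrt.mpr h0
  have hs2 : s ^ 2 = a 0 := by rw [hs]; exact Real.sq_sqrt (by linarith)
  have key : ∀ n : ℕ, a n ≤ (s * (1 + K * n)) ^ 2 := by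
    intro n
    induction n with
    | zero => simp [hs2]
    | succ n ih =>
      have h := hrec (n + 1) (by omega)
      simp only [Nat.add_sub_cancel] at h
      obtain ⟨x, hx⟩ : ∃ x : ℝ, x = s * (1 + K * n) := ⟨_, rfl⟩
      rw [← hx] at ih
      have hKn : 0 ≤ K * n := by positivity
      have hx1 : 1 ≤ x := by rw [hx]; nlinarith
      have e1 : Real.sqrt (a n) ≤ x := Real.sqrt_le_iff.mpr ⟨by linarith, ih⟩
      have hxx : 1 ≤ x ^ 2 := by nlinarith
      have e2 : Real.sqrt (a n + C₂) ≤ x * (1 + C₂) := by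
        refine Real.sqrt_le_iff.mpr ⟨by positivity, ?_⟩
        have : C₂ * 1 ≤ C₂ * x ^ 2 := mul_le_mul_of_nonneg_left hxx hC₂
        have h3 : 0 ≤ (x * C₂) ^ 2 := sq_nonneg _
        nlinarith
      have e3 : C₁ * (Real.sqrt (a n) + Real.sqrt (a n + C₂)) ≤ C₁ * (x + x * (1 + C₂)) :=
        mul_le_mul_of_nonneg_left (add_le_add e1 e2) hC₁
      have e4 : C₁ * (x + x * (1 + C₂)) = K * x := by rw [hK]; ring
      have e5 : x + K ≤ s * (1 + K * ((n + 1 : ℕ) : ℝ)) := by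
        push_cast
        rw [hx]
        nlinarith
      calc a (n + 1) ≤ (x + K) ^ 2 := by
            have : 0 ≤ K * x := by positivity
            nlinarith
        _ ≤ _ := pow_le_pow_left₀ (by positivity) e5 2
  intro n hn
  have hn' : (1 : ℝ) ≤ n := by exact_mod_cast hn
  calc a n ≤ (s * (1 + K * n)) ^ 2 := key n
    _ ≤ (s * ((1 + K) * n)) ^ 2 := by
        refine pow_le_pow_left₀ (by positivity) ?_ 2
        refine mul_le_mul_of_nonneg_left ?_ (by linarith)
        linarith
    _ = (1 + K) ^ 2 * (n : ℝ) ^ 2 * a 0 := by rw [← hs2]; ring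
end

section
/- Let C ≥ 0 be a real constant and let (c_n)_{n≥0} be the sequence of real numbers defined by c_0 ≥ 1 and the recursion c_n = c_{n-1} + C·√(c_{n-1}) for n ≥ 1. Then for every real number C̃ with C̃ ≥ max{C²/4, 1 + C}, one has c_n ≤ C̃ · n² · c_0 for all n ≥ 1. -/
/-- The inductive core of Lemma A.1: for the recursively defined sequence
`c n = c (n-1) + C √(c (n-1))` with `c 0 ≥ 1`, any `C̃ ≥ max {C²/4, 1 + C}` satisfies
`c n ≤ C̃ n² c 0` for all `n ≥ 1`. -/
theorem stmt_1 (C : ℝ) (hC : 0 ≤ C) (c : ℕ → ℝ) (hc0 : 1 ≤ c 0)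
    (hrec : ∀ n, 1 ≤ n → c n = c (n - 1) + C * Real.sqrt (c (n - 1))) :
    ∀ Ct : ℝ, max (C ^ 2 / 4) (1 + C) ≤ Ct →
      ∀ n, 1 ≤ n → c n ≤ Ct * (n : ℝ) ^ 2 * c 0 := by
  intro Ct hCt n hn
  have h1 : C ^ 2 / 4 ≤ Ct := le_trans (le_max_left _ _) hCt
  have h2 : 1 + C ≤ Ct := le_trans (le_max_right _ _) hCt
  have hCt0 : 0 ≤ Ct := by linarith
  have hs0 : 0 ≤ Real.sqrt Ct := Real.sqrt_nonneg _
  have hss : Real.sqrt Ct ^ 2 = Ct := Real.sq_sqrt hCt0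
  have hCs : C / 2 ≤ Real.sqrt Ct := Real.le_sqrt_of_sq_le (by nlinarith)
  induction n, hn using Nat.le_induction with
  | base =>
    have h := hrec 1 le_rfl
    have hq : Real.sqrt (c 0) ≤ c 0 := Real.sqrt_le_iff.mpr ⟨by linarith, by nlinarith⟩
    simp only [Nat.sub_self] at h
    rw [h]
    push_cast
    nlinarith [mul_le_mul_of_nonneg_left hq hC]
  | succ n hn ih =>
    have h := hrec (n + 1) (by omega)
    simp only [Nat.add_sub_cancel] at h
    have hn0 : (0 : ℝ) ≤ n := Nat.cast_nonneg n
    have hq : Real.sqrt (c n) ≤ Real.sqrt Ct * n * c 0 := by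
      refine Real.sqrt_le_iff.mpr ⟨by positivity, ih.trans ?_⟩
      have e : (Real.sqrt Ct * n * c 0) ^ 2 = Ct * (n : ℝ) ^ 2 * (c 0 ^ 2) := by
        rw [← hss]; simp only [hss]; rw [mul_pow, mul_pow, hss]
      rw [e]
      exact mul_le_mul_of_nonneg_left (by nlinarith) (by positivity)
    have h3 : C * Real.sqrt (c n) ≤ C * (Real.sqrt Ct * n * c 0) :=
      mul_le_mul_of_nonneg_left hq hC
    have h4 : C * Real.sqrt Ct ≤ 2 * Ct := by nlinarith
    have h5 : (C * Real.sqrt Ct) * (n * c 0) ≤ 2 * Ct * (n * c 0) :=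
      mul_le_mul_of_nonneg_right h4 (by positivity)
    have h6 : 0 ≤ Ct * c 0 := by positivity
    rw [h]
    push_cast
    nlinarith
end

section
/- Let h : ℕ → ℝ be a sequence with h_n ≥ 1 for all n ≥ 0, and suppose there exists a constant C₀ ≥ 1 such that h_{n+1} ≤ C₀ · h_n for all n ≥ 0. Then for every integer k ≥ 1, limsup_{n→∞} h_n^{1/n} = limsup_{n→∞} (h_{nk})^{1/(nk)}. -/
/-- If `h n ≥ 1` and `h (n+1) ≤ C₀ h n` for some `C₀ ≥ 1`, then for every `k ≥ 1` the limsup of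
`h n ^ (1/n)` equals the limsup of `h (n k) ^ (1/(n k))`. -/
theorem stmt_7 (h : ℕ → ℝ) (hh : ∀ n, 1 ≤ h n) (C₀ : ℝ) (hC₀ : 1 ≤ C₀)
    (hstep : ∀ n, h (n + 1) ≤ C₀ * h n) (k : ℕ) (hk : 1 ≤ k) :
    Filter.limsup (fun n : ℕ => h n ^ (1 / (n : ℝ))) Filter.atTop =
      Filter.limsup (fun n : ℕ => h (n * k) ^ (1 / ((n * k : ℕ) : ℝ))) Filter.atTop := by
  have hC0 : 0 ≤ C₀ := by linarith
  have hiter : ∀ m j, h (m + j) ≤ C₀ ^ j * h m := by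
    intro m j
    induction j with
    | zero => simp
    | succ j ih =>
      calc h (m + (j + 1)) ≤ C₀ * h (m + j) := hstep _
        _ ≤ C₀ * (C₀ ^ j * h m) := by gcongr
        _ = _ := by ring
  have hlow : ∀ n, 1 ≤ h n ^ (1 / (n : ℝ)) := fun n =>
    Real.one_le_rpow (hh n) (by positivity)
  have hup : ∀ n, h n ^ (1 / (n : ℝ)) ≤ C₀ * h 0 := by
    intro n
    rcases Nat.eq_zero_or_pos n with rfl | hn
    · simp only [Nat.cast_zero, div_zero, Real.rpow_zero]
      nlinarith [hh 0]
    · have h1 : h n ≤ (C₀ * h 0) ^ n := by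
        have h2 := hiter 0 n
        rw [zero_add] at h2
        rw [mul_pow]
        refine h2.trans ?_
        gcongr
        exact le_self_pow₀ (hh 0) hn.ne'
      have h0 : 0 ≤ C₀ * h 0 := mul_nonneg hC0 (by linarith [hh 0])
      calc h n ^ (1 / (n : ℝ)) ≤ ((C₀ * h 0) ^ n) ^ (1 / (n : ℝ)) :=
            Real.rpow_le_rpow (by linarith [hh n]) h1 (by positivity)
        _ = C₀ * h 0 := by
          rw [one_div]; exact Real.pow_rpow_inv_natCast h0 hn.ne'
  have hkpos : 0 < k := hk
  have hbA : Filter.IsBoundedUnder (· ≤ ·) Filter.atTop (fun n : ℕ => h n ^ (1 / (n : ℝ))) :=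
    Filter.isBoundedUnder_of ⟨_, hup⟩
  have hbB : Filter.IsBoundedUnder (· ≤ ·) Filter.atTop
      (fun n : ℕ => h (n * k) ^ (1 / ((n * k : ℕ) : ℝ))) :=
    Filter.isBoundedUnder_of ⟨_, fun n => hup (n * k)⟩
  have hcA : Filter.IsCoboundedUnder (· ≤ ·) Filter.atTop (fun n : ℕ => h n ^ (1 / (n : ℝ))) :=
    (Filter.isBoundedUnder_of (r := (· ≥ ·)) ⟨_, hlow⟩).isCoboundedUnder_le
  have hcB : Filter.IsCoboundedUnder (· ≤ ·) Filter.atTop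
      (fun n : ℕ => h (n * k) ^ (1 / ((n * k : ℕ) : ℝ))) :=
    (Filter.isBoundedUnder_of (r := (· ≥ ·)) ⟨_, fun n => hlow (n * k)⟩).isCoboundedUnder_le
  apply le_antisymm
  · apply le_of_forall_gt_imp_ge_of_dense
    intro x hx
    obtain ⟨y, hy1, hy2⟩ := exists_between hx
    have hev := Filter.eventually_lt_of_limsup_lt hy1 hbB
    have hdiv : Filter.Tendsto (fun n : ℕ => n / k) Filter.atTop Filter.atTop :=
      Nat.tendsto_div_const_atTop hkpos.ne'
    have hc : Filter.Tendsto (fun n : ℕ => (C₀ ^ k) ^ (1 / (n : ℝ)) * y) Filter.atTop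
        (nhds (1 * y)) := by
      apply Filter.Tendsto.mul_const
      have := (tendsto_const_nhds (x := C₀ ^ k)).rpow
        (tendsto_one_div_atTop_nhds_zero_nat (𝕜 := ℝ)) (Or.inl (by positivity))
      simpa using this
    rw [one_mul] at hc
    refine Filter.limsup_le_of_le hcA ?_
    filter_upwards [hdiv.eventually hev, hc.eventually_lt_const hy2,
      Filter.eventually_ge_atTop k] with n h1 h2 h3
    have hm : 0 < n / k := Nat.div_pos h3 hkpos
    have hmk : 0 < n / k * k := Nat.mul_pos hm hkpos
    have hle : n / k * k ≤ n := Nat.div_mul_le_self n k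
    have hA : h n ≤ C₀ ^ k * h (n / k * k) := by
      have h4 := hiter (n / k * k) (n % k)
      rw [Nat.div_add_mod'] at h4
      refine h4.trans ?_
      have := hh (n / k * k)
      gcongr
      exact (Nat.mod_lt _ hkpos).le
    have hpos : 0 ≤ h (n / k * k) := by linarith [hh (n / k * k)]
    calc h n ^ (1 / (n : ℝ)) ≤ (C₀ ^ k * h (n / k * k)) ^ (1 / (n : ℝ)) :=
          Real.rpow_le_rpow (by linarith [hh n]) hA (by positivity)
      _ = (C₀ ^ k) ^ (1 / (n : ℝ)) * h (n / k * k) ^ (1 / (n : ℝ)) :=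
          Real.mul_rpow (by positivity) hpos
      _ ≤ (C₀ ^ k) ^ (1 / (n : ℝ)) * h (n / k * k) ^ (1 / ((n / k * k : ℕ) : ℝ)) := by
          refine mul_le_mul_of_nonneg_left ?_ (by positivity)
          apply Real.rpow_le_rpow_of_exponent_le (hh _)
          apply one_div_le_one_div_of_le
          · exact_mod_cast hmk
          · exact_mod_cast hle
      _ ≤ (C₀ ^ k) ^ (1 / (n : ℝ)) * y :=
          mul_le_mul_of_nonneg_left h1.le (by positivity)
      _ ≤ x := h2.le
  · apply le_of_forall_gt_imp_ge_of_dense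
    intro x hx
    have hev := Filter.eventually_lt_of_limsup_lt hx hbA
    have hmul : Filter.Tendsto (fun n : ℕ => n * k) Filter.atTop Filter.atTop :=
      Filter.tendsto_id.atTop_mul_const' hkpos
    refine Filter.limsup_le_of_le hcB ?_
    filter_upwards [hmul.eventually hev] with n hn
    exact hn.le
end

section
/- Let ρ > 1 and C₁, C₂, γ ≥ 0 be real constants, and let (a_n)_{n≥0} be a sequence of positive real numbers with a_0 ≥ 1 satisfying a_n ≤ ρ·a_{n-1} + C₁·√(a_{n-1}) + C₂·√(a_{n-1} + γ) for all n ≥ 1. Then there exists a constant K > 0 depending only on ρ, C₁, C₂, γ such that a_n ≤ K · ρ^n · a_0 for all n ≥ 0. -/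
/-- Sequence lemma behind Theorem 4.1(2): if `ρ > 1`, `C₁, C₂, γ ≥ 0` and a positive sequence
with `a 0 ≥ 1` satisfies `a n ≤ ρ a (n-1) + C₁ √(a (n-1)) + C₂ √(a (n-1) + γ)`, then there is
`K > 0` depending only on `ρ, C₁, C₂, γ` with `a n ≤ K ρ^n a 0` for all `n`. -/
theorem stmt_9 (ρ C₁ C₂ γ : ℝ) (hρ : 1 < ρ) (hC₁ : 0 ≤ C₁) (hC₂ : 0 ≤ C₂) (hγ : 0 ≤ γ) :
    ∃ K : ℝ, 0 < K ∧ ∀ a : ℕ → ℝ, (∀ n, 0 < a n) → 1 ≤ a 0 →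
      (∀ n, 1 ≤ n → a n ≤ ρ * a (n - 1) + C₁ * Real.sqrt (a (n - 1))
        + C₂ * Real.sqrt (a (n - 1) + γ)) →
      ∀ n : ℕ, a n ≤ K * ρ ^ n * a 0 := by
  obtain ⟨s, hs1, hsρ⟩ : ∃ s : ℝ, 1 < s ∧ s ^ 2 = ρ :=
    ⟨Real.sqrt ρ, by rw [Real.lt_sqrt (by norm_num)]; linarith, Real.sq_sqrt (by linarith)⟩
  obtain ⟨g, hg0, hg⟩ : ∃ g : ℝ, 0 ≤ g ∧ g ^ 2 = γ :=
    ⟨Real.sqrt γ, Real.sqrt_nonneg _, Real.sq_sqrt hγ⟩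
  have hCg : 0 ≤ C₂ * g := mul_nonneg hC₂ hg0
  obtain ⟨E, hE⟩ : ∃ E : ℝ, E = C₁ + C₂ + C₂ * g + 1 := ⟨_, rfl⟩
  have hE1 : 1 ≤ E := by linarith
  obtain ⟨F, hF⟩ : ∃ F : ℝ, F * (s - 1) = E :=
    ⟨E / (s - 1), div_mul_cancel₀ _ (by linarith)⟩
  have hF0 : 0 < F := by
    by_contra h
    nlinarith
  refine ⟨(1 + F) ^ 2, by positivity, ?_⟩
  intro a ha ha0 hrec n
  have step : ∀ n, Real.sqrt (a (n + 1)) ≤ s * Real.sqrt (a n) + E := by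
    intro n
    have h := hrec (n + 1) (by omega)
    rw [Nat.add_sub_cancel] at h
    have hb0 := Real.sqrt_nonneg (a n)
    have hb2 := Real.sq_sqrt (ha n).le
    have hadd : Real.sqrt (a n + γ) ≤ Real.sqrt (a n) + g := by
      apply Real.sqrt_le_iff.mpr
      refine ⟨by positivity, ?_⟩
      nlinarith [mul_nonneg hb0 hg0]
    apply Real.sqrt_le_iff.mpr
    generalize Real.sqrt (a n) = b at *
    refine ⟨by positivity, ?_⟩
    have h1 := mul_le_mul_of_nonneg_left hadd hC₂
    have h2 : (C₁ + C₂) * b ≤ E * b := mul_le_mul_of_nonneg_right (by linarith) hb0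
    have hEb : 0 ≤ E * b := by positivity
    have h3 : E * b ≤ s * (E * b) := by nlinarith
    have h4 : E ≤ E ^ 2 := by nlinarith
    have h5 : (s * b + E) ^ 2 = ρ * a n + 2 * (s * (E * b)) + E ^ 2 := by
      rw [← hsρ, ← hb2]; ring
    nlinarith
  have ind : ∀ n, Real.sqrt (a n) + F ≤ s ^ n * (Real.sqrt (a 0) + F) := by
    intro n
    induction n with
    | zero => simp
    | succ n ih =>
      have h := step n
      have h2 := mul_le_mul_of_nonneg_left ih (by linarith : 0 ≤ s)
      rw [pow_succ]
      nlinarith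
  have hb : 1 ≤ Real.sqrt (a 0) := Real.one_le_sqrt.mpr ha0
  have hsn : 0 < s ^ n := by positivity
  have key : Real.sqrt (a n) ≤ s ^ n * ((1 + F) * Real.sqrt (a 0)) := by
    have h1 : Real.sqrt (a 0) + F ≤ (1 + F) * Real.sqrt (a 0) := by nlinarith
    have h2 := mul_le_mul_of_nonneg_left h1 hsn.le
    linarith [ind n]
  calc a n = Real.sqrt (a n) ^ 2 := (Real.sq_sqrt (ha n).le).symm
    _ ≤ (s ^ n * ((1 + F) * Real.sqrt (a 0))) ^ 2 :=
      pow_le_pow_left₀ (Real.sqrt_nonneg _) key 2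
    _ = (1 + F) ^ 2 * (s ^ 2) ^ n * Real.sqrt (a 0) ^ 2 := by ring
    _ = (1 + F) ^ 2 * ρ ^ n * a 0 := by rw [hsρ, Real.sq_sqrt (ha 0).le]
end

section
/- Let ρ ≥ 1 and C₁, C₂, γ ≥ 0 be real constants, and let (a_n)_{n≥0} be a sequence of positive real numbers with a_0 ≥ 1 satisfying a_n ≤ ρ·a_{n-1} + C₁·√(a_{n-1}) + C₂·√(a_{n-1} + γ) for all n ≥ 1. Then there exists a constant K > 0 depending only on ρ, C₁, C₂, γ such that a_n ≤ K · n² · ρ^n · a_0 for all n ≥ 1. -/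
/-- Sequence lemma behind the Claim in Theorem 3.2: if `ρ ≥ 1`, `C₁, C₂, γ ≥ 0` and a positive
sequence with `a 0 ≥ 1` satisfies `a n ≤ ρ a (n-1) + C₁ √(a (n-1)) + C₂ √(a (n-1) + γ)`, then
there is `K > 0` depending only on `ρ, C₁, C₂, γ` with `a n ≤ K n² ρ^n a 0` for all `n ≥ 1`. -/
theorem stmt_10 (ρ C₁ C₂ γ : ℝ) (hρ : 1 ≤ ρ) (hC₁ : 0 ≤ C₁) (hC₂ : 0 ≤ C₂) (hγ : 0 ≤ γ) :
    ∃ K : ℝ, 0 < K ∧ ∀ a : ℕ → ℝ, (∀ n, 0 < a n) → 1 ≤ a 0 →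
      (∀ n, 1 ≤ n → a n ≤ ρ * a (n - 1) + C₁ * Real.sqrt (a (n - 1))
        + C₂ * Real.sqrt (a (n - 1) + γ)) →
      ∀ n : ℕ, 1 ≤ n → a n ≤ K * (n : ℝ) ^ 2 * ρ ^ n * a 0 := by
  obtain ⟨g, hg⟩ : ∃ g, g = Real.sqrt γ := ⟨_, rfl⟩
  have hg0 : 0 ≤ g := hg ▸ Real.sqrt_nonneg γ
  have hgg : g ^ 2 = γ := by rw [hg]; exact Real.sq_sqrt hγ
  obtain ⟨D, hD⟩ : ∃ D, D = C₁ + C₂ + C₂ * g := ⟨_, rfl⟩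
  have hCg : 0 ≤ C₂ * g := mul_nonneg hC₂ hg0
  have hD0 : 0 ≤ D := by rw [hD]; linarith
  obtain ⟨L, hL⟩ : ∃ L, L = 1 + D := ⟨_, rfl⟩
  have hL1 : 1 ≤ L := by linarith
  refine ⟨4 * L ^ 2, by positivity, ?_⟩
  intro a ha h0 hrec
  have hT : ∀ n : ℕ, 1 ≤ ρ ^ n * a 0 := fun n =>
    one_le_mul_of_one_le_of_one_le (one_le_pow₀ hρ) h0
  have key : ∀ n : ℕ, a n ≤ L ^ 2 * ((n : ℝ) + 1) ^ 2 * (ρ ^ n * a 0) := by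
    intro n
    induction n with
    | zero =>
      have : 1 ≤ L ^ 2 := one_le_pow₀ hL1
      simp only [Nat.cast_zero, pow_zero]
      nlinarith
    | succ n ih =>
      have hr := hrec (n + 1) (by omega)
      simp only [Nat.add_sub_cancel] at hr
      have hT1 := hT n
      have e : ρ ^ (n + 1) * a 0 = ρ * (ρ ^ n * a 0) := by ring
      rw [e]
      generalize ρ ^ n * a 0 = T at *
      push_cast
      have hm : (1 : ℝ) ≤ (n : ℝ) + 1 := by
        have : (0 : ℝ) ≤ n := Nat.cast_nonneg n
        linarith
      have e2 : (n : ℝ) + 1 + 1 = ((n : ℝ) + 1) + 1 := rfl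
      generalize (n : ℝ) + 1 = m at *
      obtain ⟨Y, hY⟩ : ∃ Y, Y = L * m * T := ⟨_, rfl⟩
      have hLm : 1 ≤ L * m := one_le_mul_of_one_le_of_one_le hL1 hm
      have hY1 : 1 ≤ Y := by rw [hY]; exact one_le_mul_of_one_le_of_one_le hLm hT1
      have haY : a n ≤ Y ^ 2 := by
        have h1 : T ≤ T ^ 2 := by nlinarith
        have h2 : (L ^ 2 * m ^ 2) * T ≤ (L ^ 2 * m ^ 2) * T ^ 2 :=
          mul_le_mul_of_nonneg_left h1 (by positivity)
        rw [hY]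
        nlinarith
      have hs1 : Real.sqrt (a n) ≤ Y := Real.sqrt_le_iff.2 ⟨by linarith, haY⟩
      have hs2 : Real.sqrt (a n + γ) ≤ Y + g :=
        Real.sqrt_le_iff.2 ⟨by linarith, by nlinarith [mul_nonneg (by linarith : 0 ≤ Y) hg0]⟩
      have b1 := mul_le_mul_of_nonneg_left hs1 hC₁
      have b2 := mul_le_mul_of_nonneg_left hs2 hC₂
      have b3 : C₂ * g ≤ C₂ * g * Y := le_mul_of_one_le_right hCg hY1
      have b4 : ρ * a n ≤ ρ * (L ^ 2 * m ^ 2 * T) :=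
        mul_le_mul_of_nonneg_left ih (by linarith)
      have b5 : D * Y ≤ L * Y := mul_le_mul_of_nonneg_right (by linarith) (by linarith)
      have b6 : L * Y ≤ ρ * (L * Y) :=
        le_mul_of_one_le_left (mul_nonneg (by linarith) (by linarith)) hρ
      have b7 : 0 ≤ ρ * (L ^ 2 * (m + 1) * T) := by positivity
      have b8 : D * Y = C₁ * Y + C₂ * Y + C₂ * g * Y := by rw [hD]; ring
      have b9 : L ^ 2 * (m + 1) ^ 2 * (ρ * T)
          = ρ * (L ^ 2 * m ^ 2 * T) + ρ * (L * Y) + ρ * (L ^ 2 * (m + 1) * T) := by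
        rw [hY]; ring
      rw [b9]
      linarith
  intro n hn
  have hn' : (1 : ℝ) ≤ n := by exact_mod_cast hn
  have h1 : ((n : ℝ) + 1) ^ 2 ≤ 4 * (n : ℝ) ^ 2 := by nlinarith
  have h2 := hT n
  calc a n ≤ L ^ 2 * ((n : ℝ) + 1) ^ 2 * (ρ ^ n * a 0) := key n
    _ ≤ L ^ 2 * (4 * (n : ℝ) ^ 2) * (ρ ^ n * a 0) := by gcongr
    _ = 4 * L ^ 2 * (n : ℝ) ^ 2 * ρ ^ n * a 0 := by ring
end

section
/- Let (x_n)_{n≥0} be a sequence of positive real numbers with x_0 ≥ 1, let w : ℕ → ℝ be a sequence of nonnegative real numbers such that the series Σ_{k=1}^{∞} k·w_k converges with sum W, and let C, D > 0 be constants such that x_k ≤ D·k²·x_0 for all k ≥ 1 and x_n ≤ C·(√(x_0) + Σ_{k=1}^{n-1} w_k·√(x_k) + x_0) for all n ≥ 1. Then there exists a constant C′ > 0 depending only on C, D and W such that x_n ≤ C′·x_0 for all n ≥ 1. -/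
/-- Bootstrapping step in Theorem 1.6(2): if `x` is positive with `x 0 ≥ 1`, `w` is nonnegative
with `∑ k, k * w k = W` (convergent), `x k ≤ D k² x 0` for `k ≥ 1` and
`x n ≤ C (√(x 0) + ∑_{1 ≤ k < n} w k √(x k) + x 0)` for `n ≥ 1`, then there is `C' > 0`
depending only on `C, D, W` with `x n ≤ C' x 0` for all `n ≥ 1`. -/
theorem stmt_11 (C D W : ℝ) (hC : 0 < C) (hD : 0 < D) :
    ∃ C' : ℝ, 0 < C' ∧ ∀ (x w : ℕ → ℝ), (∀ n, 0 < x n) → 1 ≤ x 0 → (∀ k, 0 ≤ w k) →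
      HasSum (fun k : ℕ => (k : ℝ) * w k) W →
      (∀ k, 1 ≤ k → x k ≤ D * (k : ℝ) ^ 2 * x 0) →
      (∀ n, 1 ≤ n → x n ≤ C * (Real.sqrt (x 0)
        + (∑ k ∈ Finset.Ico 1 n, w k * Real.sqrt (x k)) + x 0)) →
      ∀ n, 1 ≤ n → x n ≤ C' * x 0 := by
  refine ⟨C * (2 + Real.sqrt D * |W|), by positivity, ?_⟩
  intro x w hx h0 hw hW hD2 hrec n hn
  have hs0 : Real.sqrt (x 0) ≤ x 0 := by
    rw [Real.sqrt_le_left (by linarith)]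
    nlinarith
  have hk : ∀ k, 1 ≤ k → Real.sqrt (x k) ≤ Real.sqrt D * k * x 0 := by
    intro k hk
    apply Real.sqrt_le_iff.mpr
    refine ⟨by have := hx 0; positivity, (hD2 k hk).trans ?_⟩
    rw [mul_pow, mul_pow, Real.sq_sqrt hD.le]
    have : x 0 ≤ x 0 ^ 2 := by nlinarith
    gcongr
  have hsum : ∑ k ∈ Finset.Ico 1 n, w k * Real.sqrt (x k) ≤ Real.sqrt D * |W| * x 0 := by
    calc ∑ k ∈ Finset.Ico 1 n, w k * Real.sqrt (x k)
        ≤ ∑ k ∈ Finset.Ico 1 n, (Real.sqrt D * x 0) * ((k : ℝ) * w k) := by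
          apply Finset.sum_le_sum
          intro k hk'
          have h1 := mul_le_mul_of_nonneg_left (hk k (Finset.mem_Ico.mp hk').1) (hw k)
          linarith
      _ = (Real.sqrt D * x 0) * ∑ k ∈ Finset.Ico 1 n, ((k : ℝ) * w k) := by
          rw [Finset.mul_sum]
      _ ≤ (Real.sqrt D * x 0) * |W| := by
          have := hx 0
          have h2 : ∑ k ∈ Finset.Ico 1 n, ((k : ℝ) * w k) ≤ W :=
            sum_le_hasSum _ (fun k _ => mul_nonneg (Nat.cast_nonneg k) (hw k)) hW
          have h3 := h2.trans (le_abs_self W)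
          gcongr
      _ = Real.sqrt D * |W| * x 0 := by ring
  refine (hrec n hn).trans ?_
  rw [mul_assoc]
  apply mul_le_mul_of_nonneg_left _ hC.le
  linarith
end
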